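/- Let S ⊆ ℝ² be a measurable set of infinite Lebesgue measure. Then S contains the four vertices of an isosceles trapezoid of area 1; that is, there exist points a, b, c, d ∈ S and a real number t with 0 < t and t ≠ 1 such that c − d = t·(b − a) ≠ 0, dist(a,d) = dist(b,c), the quadrilateral with vertices a, b, c, d (in this cyclic order) is nondegenerate, and its shoelace area (1/2)·|det(b − a, d − a) + det(c − b, d − b)| equals 1. -/

import Mathlib

open MeasureTheory Metric

/-- `det(u,v) = u₁v₂ − u₂v₁` for vectors in the Euclidean plane. -/
def det2 (u v : EuclideanSpace ℝ (Fin 2)) : ℝ := u 0 * v 1 - u 1 * v 0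


def DPt (S : Set ℂ) (z : ℂ) : Prop :=
  ∀ ε : ℝ, 0 < ε → ∃ r₀ : ℝ, 0 < r₀ ∧ ∀ r : ℝ, 0 < r → r < r₀ →
    volume (Sᶜ ∩ closedBall z r) ≤ ENNReal.ofReal (ε * r ^ 2)

lemma ae_DPt (S : Set ℂ) (hS : MeasurableSet S) : ∀ᵐ z : ℂ, z ∈ S → DPt S z := by
  filter_upwards [Besicovitch.ae_tendsto_measure_inter_div_of_measurableSet volume hS.compl]
    with z hz hzS ε hε
  have h0 : (Sᶜ).indicator (1 : ℂ → ENNReal) z = 0 := by simp [hzS]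
  rw [h0] at hz
  have hpos : (0 : ENNReal) < ENNReal.ofReal (ε / 4) := by simpa using hε
  have := hz.eventually (gt_mem_nhds hpos)
  rw [eventually_nhdsWithin_iff, Metric.eventually_nhds_iff] at this
  obtain ⟨r₀, hr₀, h⟩ := this
  refine ⟨r₀, hr₀, fun r hr hrr => ?_⟩
  have h1 := (h (y := r) (by simpa [abs_of_pos hr] using hrr) hr).le
  have hvol : volume (closedBall z r) ≤ ENNReal.ofReal (4 * r ^ 2) := by
    rw [Complex.volume_closedBall, ← ENNReal.ofReal_pow hr.le,
      mul_comm (4 : ℝ), ENNReal.ofReal_mul (by positivity)]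
    gcongr
    rw [← ENNReal.ofReal_coe_nnreal, NNReal.coe_real_pi]
    exact ENNReal.ofReal_le_ofReal Real.pi_le_four
  rw [ENNReal.div_le_iff_le_mul] at h1
  · calc _ ≤ _ := h1
      _ ≤ ENNReal.ofReal (ε / 4) * ENNReal.ofReal (4 * r ^ 2) := by gcongr
      _ = _ := by
        rw [← ENNReal.ofReal_mul (by positivity)]; congr 1; ring
  · left; exact (measure_closedBall_pos _ _ hr).ne'
  · left; exact measure_closedBall_lt_top.ne

lemma slice2 (E : Set (ℝ × ℝ)) (hE : MeasurableSet E) (a b : ℝ × ℝ) (hab : a.2 = b.2)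
    (δ ε : ℝ) (hδ : 0 < δ) (hε : 0 ≤ ε)
    (ha : volume (E ∩ closedBall a δ) ≤ ENNReal.ofReal (ε * δ ^ 2))
    (hb : volume (E ∩ closedBall b δ) ≤ ENNReal.ofReal (ε * δ ^ 2)) :
    ∃ t : ℝ, |t - a.2| ≤ δ ∧
      volume {s : ℝ | (s, t) ∈ E ∧ |s - a.1| ≤ δ} ≤ ENNReal.ofReal (ε * δ) ∧
      volume {s : ℝ | (s, t) ∈ E ∧ |s - b.1| ≤ δ} ≤ ENNReal.ofReal (ε * δ) := by
  have mA : MeasurableSet (E ∩ closedBall a δ) := hE.inter measurableSet_closedBall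
  have mB : MeasurableSet (E ∩ closedBall b δ) := hE.inter measurableSet_closedBall
  rw [Measure.volume_eq_prod, Measure.prod_apply_symm mA] at ha
  rw [Measure.volume_eq_prod, Measure.prod_apply_symm mB] at hb
  set FA : ℝ → ENNReal := fun t => volume ((fun s : ℝ => (s, t)) ⁻¹' (E ∩ closedBall a δ)) with hFA
  set FB : ℝ → ENNReal := fun t => volume ((fun s : ℝ => (s, t)) ⁻¹' (E ∩ closedBall b δ)) with hFB
  have mFA : Measurable FA := measurable_measure_prodMk_right mA
  have mFB : Measurable FB := measurable_measure_prodMk_right mB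
  have hvol : volume (closedBall a.2 δ) = ENNReal.ofReal (2 * δ) := Real.volume_closedBall _ _
  have h2 : (0 : ENNReal) < ENNReal.ofReal (2 * δ) := by simpa using hδ
  obtain ⟨t, ht, hle⟩ := exists_le_setLAverage (μ := volume) (s := closedBall a.2 δ)
    (f := fun t => FA t + FB t) (by rw [hvol]; exact h2.ne') (by rw [hvol]; exact ENNReal.ofReal_ne_top)
    (mFA.add mFB).aemeasurable
  have hsum : FA t + FB t ≤ ENNReal.ofReal (ε * δ) := by
    refine hle.trans ?_
    rw [setLAverage_eq, hvol]
    apply ENNReal.div_le_of_le_mul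
    calc _ ≤ ∫⁻ t, (FA t + FB t) := setLIntegral_le_lintegral _ _
      _ = (∫⁻ t, FA t) + ∫⁻ t, FB t := lintegral_add_left mFA _
      _ ≤ ENNReal.ofReal (ε * δ ^ 2) + ENNReal.ofReal (ε * δ ^ 2) := add_le_add ha hb
      _ = _ := by
        rw [← ENNReal.ofReal_add (by positivity) (by positivity),
          ← ENNReal.ofReal_mul (by positivity)]; congr 1; ring
  rw [mem_closedBall, Real.dist_eq] at ht
  refine ⟨t, ht, le_trans (measure_mono ?_) (le_self_add.trans hsum),
    le_trans (measure_mono ?_) (le_add_self.trans hsum)⟩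
  · rintro s ⟨h1, h2⟩
    exact ⟨h1, by simp [Prod.dist_eq, Real.dist_eq, h2, ht]⟩
  · rintro s ⟨h1, h2⟩
    exact ⟨h1, by simp [Prod.dist_eq, Real.dist_eq, h2, ← hab, ht]⟩

lemma step2 (T : Set (ℝ × ℝ)) (hT : MeasurableSet T) (h₀ : ℝ) (hh : 4 ≤ h₀)
    (δ : ℝ) (hδ : 0 < δ) (hδ1 : δ ≤ 1)
    (hx : volume (Tᶜ ∩ closedBall (0, 0) δ) ≤ ENNReal.ofReal (1 / 8 * δ ^ 2))
    (ha : volume (Tᶜ ∩ closedBall (-(1 / h₀), h₀) δ) ≤ ENNReal.ofReal (1 / 8 * δ ^ 2))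
    (hb : volume (Tᶜ ∩ closedBall (1 / h₀, h₀) δ) ≤ ENNReal.ofReal (1 / 8 * δ ^ 2)) :
    ∃ m y1 y2 p q : ℝ, 0 < q ∧ q < p ∧ (p + q) * (y1 - y2) = 1 ∧
      (m - p, y1) ∈ T ∧ (m + p, y1) ∈ T ∧ (m + q, y2) ∈ T ∧ (m - q, y2) ∈ T := by
  obtain ⟨y2, hy2, hx', -⟩ := slice2 _ hT.compl _ _ rfl δ (1/8) hδ (by norm_num) hx hx
  obtain ⟨y1, hy1, ha', hb'⟩ := slice2 _ hT.compl
    (-(1 / h₀), h₀) (1 / h₀, h₀) rfl δ (1/8) hδ (by norm_num) ha hb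
  simp only [sub_zero] at hy2 hx'
  simp only at hy1 ha' hb'
  rw [abs_le] at hy1 hy2
  obtain ⟨h, hhdef⟩ : ∃ h, h = y1 - y2 := ⟨_, rfl⟩
  have hh2 : 2 ≤ h := by linarith
  have hpos : 0 < h := by linarith
  have h0pos : 0 < h₀ := by linarith
  obtain ⟨q, hq0, hq1, hq2⟩ : ∃ q : ℝ, 0 < q ∧ q ≤ δ / 4 ∧ q ≤ 1 / h / 4 :=
    ⟨min (δ / 4) (1 / h / 4), by positivity, min_le_left _ _, min_le_right _ _⟩
  obtain ⟨p, hp⟩ : ∃ p, p = 1 / h - q := ⟨_, rfl⟩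
  have hinv : 0 < 1 / h := by positivity
  have hdiff : |1 / h - 1 / h₀| ≤ δ / 4 := by
    have : 1 / h - 1 / h₀ = (h₀ - h) / (h * h₀) := by field_simp
    rw [this, abs_div, abs_of_pos (mul_pos hpos h0pos), div_le_iff₀ (by positivity)]
    have : |h₀ - h| ≤ 2 * δ := by rw [abs_le]; constructor <;> linarith
    have : 8 ≤ h * h₀ := by nlinarith
    nlinarith
  rw [abs_le] at hdiff
  have key : ∀ (c y k : ℝ), volume {s : ℝ | (s, y) ∈ Tᶜ ∧ |s - c| ≤ δ} ≤ ENNReal.ofReal (1/8 * δ) →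
      |k - c| ≤ δ / 2 →
      volume {m : ℝ | m ∈ closedBall (0:ℝ) (δ / 2) ∧ (m + k, y) ∉ T} ≤ ENNReal.ofReal (1/8 * δ) := by
    intro c y k h1 h2
    refine le_trans ?_ h1
    rw [← measure_preimage_add_right volume k {s : ℝ | (s, y) ∈ Tᶜ ∧ |s - c| ≤ δ}]
    apply measure_mono
    rintro m ⟨hm, hmT⟩
    refine ⟨hmT, ?_⟩
    rw [mem_closedBall, Real.dist_eq, sub_zero] at hm
    rw [abs_le] at *
    constructor <;> linarith [hm.1, hm.2, h2.1, h2.2]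
  have k1 := key _ _ (-p) ha' (by rw [abs_le]; constructor <;> linarith)
  have k2 := key _ _ p hb' (by rw [abs_le]; constructor <;> linarith)
  have k3 := key 0 _ q (by simpa using hx') (by rw [abs_le]; constructor <;> linarith)
  have k4 := key 0 _ (-q) (by simpa using hx') (by rw [abs_le]; constructor <;> linarith)
  by_contra hcon
  have hcov : closedBall (0:ℝ) (δ / 2) ⊆
      (({m : ℝ | m ∈ closedBall (0:ℝ) (δ / 2) ∧ (m + (-p), y1) ∉ T} ∪
      {m : ℝ | m ∈ closedBall (0:ℝ) (δ / 2) ∧ (m + p, y1) ∉ T}) ∪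
      {m : ℝ | m ∈ closedBall (0:ℝ) (δ / 2) ∧ (m + q, y2) ∉ T}) ∪
      {m : ℝ | m ∈ closedBall (0:ℝ) (δ / 2) ∧ (m + (-q), y2) ∉ T} := by
    intro m hm
    by_contra hno
    simp only [Set.mem_union, Set.mem_ofPred_eq, hm, true_and, not_or, not_not] at hno
    obtain ⟨⟨⟨n1, n2⟩, n3⟩, n4⟩ := hno
    refine hcon ⟨m, y1, y2, p, q, hq0, by linarith, ?_, n1, n2, n3, n4⟩
    rw [← hhdef, hp]; field_simp; ring
  have hm := measure_mono (μ := volume) hcov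
  rw [Real.volume_closedBall] at hm
  have hm2 := hm.trans ((measure_union_le _ _).trans (add_le_add ((measure_union_le _ _).trans
    (add_le_add ((measure_union_le _ _).trans (add_le_add k1 k2)) k3)) k4))
  have hp8 : 0 ≤ 1/8 * δ := by positivity
  rw [← ENNReal.ofReal_add hp8 hp8, ← ENNReal.ofReal_add (by positivity) hp8,
    ← ENNReal.ofReal_add (by positivity) hp8, ENNReal.ofReal_le_ofReal_iff (by positivity)] at hm2
  linarith

lemma measure_expand (f : ℂ → ℂ) (s E : Set ℂ)
    (hf : ∀ z ∈ s, ∀ w ∈ s, dist z w ≤ 2 * dist (f z) (f w)) (hfE : Set.MapsTo f s E) :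
    volume s ≤ 4 * volume E := by
  have hinj : Set.InjOn f s := by
    intro z hz w hw h
    have := hf z hz w hw
    rw [h, dist_self, mul_zero] at this
    exact dist_le_zero.1 this
  have hL : LipschitzOnWith 2 (Function.invFunOn f s) (f '' s) := by
    apply LipschitzOnWith.of_dist_le_mul
    rintro _ ⟨z, hz, rfl⟩ _ ⟨w, hw, rfl⟩
    rw [hinj.leftInvOn_invFunOn hz, hinj.leftInvOn_invFunOn hw]
    exact hf z hz w hw
  have h1 := hL.hausdorffMeasure_image_le (d := 2) (by norm_num)
  rw [hinj.leftInvOn_invFunOn.image_image] at h1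
  have h2 : μH[(2:ℝ)] s ≤ 4 * μH[(2:ℝ)] E := by
    refine h1.trans ?_
    gcongr
    · norm_num
    · exact hfE.image_subset
  have hfin : (2 : ℝ) = Module.finrank ℝ ℂ := by simp
  have : (μH[(2:ℝ)] : Measure ℂ).IsAddHaarMeasure := by
    rw [hfin]; infer_instance
  rw [Measure.isAddLeftInvariant_eq_smul (volume : Measure ℂ) μH[(2:ℝ)]]
  simp only [Measure.smul_apply]
  rw [mul_smul_comm]
  gcongr

lemma expand_aux (x z w k : ℂ) (hk : ‖k‖ = 1) (hz : 2 ≤ ‖z - x‖) (hw : 2 ≤ ‖w - x‖) :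
    dist z w ≤ 2 * dist (z + k / (starRingEnd ℂ) (z - x)) (w + k / (starRingEnd ℂ) (w - x)) := by
  have hz0 : z - x ≠ 0 := by intro h; rw [h, norm_zero] at hz; linarith
  have hw0 : w - x ≠ 0 := by intro h; rw [h, norm_zero] at hw; linarith
  have hz1 : (starRingEnd ℂ) (z - x) ≠ 0 := (map_ne_zero _).2 hz0
  have hw1 : (starRingEnd ℂ) (w - x) ≠ 0 := (map_ne_zero _).2 hw0
  have e : k / (starRingEnd ℂ) (z - x) - k / (starRingEnd ℂ) (w - x)
      = k * (starRingEnd ℂ) (w - z) / ((starRingEnd ℂ) (z - x) * (starRingEnd ℂ) (w - x)) := by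
    rw [div_sub_div _ _ hz1 hw1, ← mul_comm k, ← mul_sub, ← map_sub]
    congr 3; ring
  have hn : ‖k / (starRingEnd ℂ) (z - x) - k / (starRingEnd ℂ) (w - x)‖ ≤ ‖z - w‖ / 4 := by
    rw [e, norm_div, norm_mul, norm_mul, hk, RCLike.norm_conj, RCLike.norm_conj, RCLike.norm_conj,
      norm_sub_rev w z, one_mul]
    apply div_le_div_of_nonneg_left (norm_nonneg _) (by norm_num)
    nlinarith
  rw [dist_eq_norm, dist_eq_norm]
  have e2 : z - w = (z + k / (starRingEnd ℂ) (z - x) - (w + k / (starRingEnd ℂ) (w - x)))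
      - (k / (starRingEnd ℂ) (z - x) - k / (starRingEnd ℂ) (w - x)) := by ring
  have := norm_sub_le (z + k / (starRingEnd ℂ) (z - x) - (w + k / (starRingEnd ℂ) (w - x)))
    (k / (starRingEnd ℂ) (z - x) - k / (starRingEnd ℂ) (w - x))
  rw [← e2] at this
  linarith [norm_nonneg (z - w)]

lemma step1 (S : Set ℂ) (hS : MeasurableSet S) (hinf : volume S = ⊤) :
    ∃ x g : ℂ, DPt S x ∧ 4 ≤ ‖g - x‖ ∧ DPt S (g + Complex.I / (starRingEnd ℂ) (g - x)) ∧
      DPt S (g + (-Complex.I) / (starRingEnd ℂ) (g - x)) := by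
  have hae := ae_DPt S hS
  have hnull : volume (S \ {z | DPt S z}) = 0 := by
    rw [ae_iff] at hae
    convert hae using 2
    ext z; simp
  have hbig : ∀ (o : ℂ) (R : ℝ), ∃ x, DPt S x ∧ R < ‖x - o‖ := by
    intro o R
    by_contra! hno
    have hsub : S ⊆ closedBall o R ∪ (S \ {z | DPt S z}) := by
      intro z hz
      by_cases hd : DPt S z
      · left; rw [mem_closedBall, dist_eq_norm]; exact hno z hd
      · right; exact ⟨hz, hd⟩
    have := (measure_mono (μ := volume) hsub).trans (measure_union_le _ _)
    rw [hinf, hnull, add_zero, top_le_iff] at this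
    exact measure_closedBall_lt_top.ne this
  obtain ⟨o, ho, -⟩ := hbig 0 0
  obtain ⟨r₀, hr₀, hr⟩ := ho (1 / 16) (by norm_num)
  obtain ⟨r, hr1, hr2, hr3⟩ : ∃ r, 0 < r ∧ r < r₀ ∧ r ≤ 1 :=
    ⟨min (r₀ / 2) 1, by positivity, (min_le_left _ _).trans_lt (by linarith), min_le_right _ _⟩
  have hE0 := hr r hr1 hr2
  obtain ⟨x, hx, hxo⟩ := hbig o (5 + 2 / r)
  have h2r : 0 < 2 / r := by positivity
  have hfar : ∀ g ∈ closedBall o (r / 2), 4 + 2 / r ≤ ‖g - x‖ := by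
    intro g hg
    rw [mem_closedBall, dist_eq_norm] at hg
    have := norm_sub_le_norm_sub_add_norm_sub x g o
    rw [norm_sub_rev x g] at this
    linarith
  obtain ⟨E, hEdef⟩ : ∃ E, E = {z | ¬ DPt S z} ∩ closedBall o r := ⟨_, rfl⟩
  have hE : volume E ≤ ENNReal.ofReal (1 / 16 * r ^ 2) := by
    have hsub : E ⊆ (Sᶜ ∩ closedBall o r) ∪ (S \ {z | DPt S z}) := by
      rw [hEdef]
      rintro z ⟨h1, h2⟩
      by_cases hz : z ∈ S
      · right; exact ⟨hz, h1⟩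
      · left; exact ⟨hz, h2⟩
    refine (measure_mono hsub).trans ((measure_union_le _ _).trans ?_)
    rw [hnull, add_zero]; exact hE0
  have key : ∀ k : ℂ, ‖k‖ = 1 → volume {g | g ∈ closedBall o (r / 2) ∧
      ¬ DPt S (g + k / (starRingEnd ℂ) (g - x))} ≤ 4 * ENNReal.ofReal (1 / 16 * r ^ 2) := by
    intro k hk
    refine le_trans (measure_expand (fun g => g + k / (starRingEnd ℂ) (g - x)) _ E ?_ ?_)
      (by gcongr)
    · rintro z ⟨hz, -⟩ w ⟨hw, -⟩
      exact expand_aux x z w k hk (by linarith [hfar z hz]) (by linarith [hfar w hw])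
    · rintro z ⟨hz, hzD⟩
      rw [hEdef]
      refine ⟨hzD, ?_⟩
      have h1 := hfar z hz
      rw [mem_closedBall, dist_eq_norm] at hz ⊢
      have : ‖k / (starRingEnd ℂ) (z - x)‖ ≤ r / 2 := by
        rw [norm_div, hk, RCLike.norm_conj, div_le_iff₀ (by linarith)]
        have : r / 2 * (2 / r) = 1 := by field_simp
        nlinarith
      have h3 : z + k / (starRingEnd ℂ) (z - x) - o = (z - o) + k / (starRingEnd ℂ) (z - x) := by
        ring
      rw [h3]
      exact (norm_add_le _ _).trans (by linarith)
  have k1 := key Complex.I (by simp)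
  have k2 := key (-Complex.I) (by simp)
  by_contra hcon
  have hcov : closedBall o (r / 2) ⊆
      {g | g ∈ closedBall o (r / 2) ∧ ¬ DPt S (g + Complex.I / (starRingEnd ℂ) (g - x))} ∪
      {g | g ∈ closedBall o (r / 2) ∧ ¬ DPt S (g + (-Complex.I) / (starRingEnd ℂ) (g - x))} := by
    intro g hg
    by_contra hno
    simp only [Set.mem_union, Set.mem_ofPred_eq, hg, true_and, not_or, not_not] at hno
    exact hcon ⟨x, g, hx, by linarith [hfar g hg], hno.1, hno.2⟩
  have hm := (measure_mono (μ := volume) hcov).trans ((measure_union_le _ _).trans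
    (add_le_add k1 k2))
  rw [Complex.volume_closedBall, ← ENNReal.ofReal_pow (by positivity),
    ← ENNReal.ofReal_coe_nnreal, NNReal.coe_real_pi, ← ENNReal.ofReal_mul (by positivity)] at hm
  have h4 : (4 : ENNReal) = ENNReal.ofReal 4 := by simp
  rw [h4, ← ENNReal.ofReal_mul (by norm_num), ← ENNReal.ofReal_add (by positivity) (by positivity),
    ENNReal.ofReal_le_ofReal_iff (by positivity)] at hm
  nlinarith [Real.pi_gt_three, sq_pos_of_pos hr1]

/-- The rigid frame with origin `x` and first axis `u`. -/
noncomputable def frame (x u : ℂ) (z : ℝ × ℝ) : ℂ := x + u * (z.1 + z.2 * Complex.I)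

lemma frame_mp (x u : ℂ) (hu : ‖u‖ = 1) : MeasurePreserving (frame x u) volume volume := by
  have h1 : MeasurePreserving (fun z : ℝ × ℝ => Complex.measurableEquivRealProd.symm z) :=
    Complex.volume_preserving_equiv_real_prod.symm
  have h2 := (rotation ⟨u, by simpa [Submonoid.unitSphere] using hu⟩ : ℂ ≃ₗᵢ[ℝ] ℂ).measurePreserving
  have h3 := measurePreserving_add_left (volume : Measure ℂ) x
  have h4 := h3.comp (h2.comp h1)
  have e : frame x u = (fun y => x + y) ∘ (rotation ⟨u, by simpa [Submonoid.unitSphere] using hu⟩ :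
      ℂ ≃ₗᵢ[ℝ] ℂ) ∘ (fun z : ℝ × ℝ => Complex.measurableEquivRealProd.symm z) := by
    funext z
    have : Complex.measurableEquivRealProd.symm z = z.1 + z.2 * Complex.I := by
      apply Complex.ext <;> simp
    change x + _ = x + u * (Complex.measurableEquivRealProd.symm z)
    rw [this]
  rw [e]
  exact h4

lemma frame_dens (S : Set ℂ) (hS : MeasurableSet S) (x u : ℂ) (hu : ‖u‖ = 1) (z : ℝ × ℝ)
    (h : DPt S (frame x u z)) : ∃ r₀ : ℝ, 0 < r₀ ∧ ∀ δ : ℝ, 0 < δ → δ < r₀ →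
    volume ((frame x u ⁻¹' S)ᶜ ∩ closedBall z δ) ≤ ENNReal.ofReal (1 / 8 * δ ^ 2) := by
  obtain ⟨r₀, hr₀, hr⟩ := h (1 / 32) (by norm_num)
  refine ⟨r₀ / 2, by positivity, fun δ hδ hδr => ?_⟩
  have h1 := hr (2 * δ) (by positivity) (by linarith)
  have h2 : (1 / 32 : ℝ) * (2 * δ) ^ 2 = 1 / 8 * δ ^ 2 := by ring
  rw [h2] at h1
  refine le_trans ?_ h1
  rw [← (frame_mp x u hu).measure_preimage
    (hS.compl.inter measurableSet_closedBall).nullMeasurableSet]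
  apply measure_mono
  rintro w ⟨hw1, hw2⟩
  refine ⟨hw1, ?_⟩
  rw [mem_closedBall, Prod.dist_eq, max_le_iff, Real.dist_eq, Real.dist_eq] at hw2
  rw [mem_closedBall, dist_eq_norm]
  have e : frame x u w - frame x u z
      = u * (((w.1 - z.1 : ℝ) : ℂ) + ((w.2 - z.2 : ℝ) : ℂ) * Complex.I) := by
    simp only [frame]; push_cast; ring
  rw [e, norm_mul, hu, one_mul]
  refine (norm_add_le _ _).trans ?_
  rw [norm_mul, Complex.norm_I, mul_one, Complex.norm_real, Complex.norm_real, Real.norm_eq_abs,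
    Real.norm_eq_abs]
  linarith [hw2.1, hw2.2]

lemma main_complex (S : Set ℂ) (hS : MeasurableSet S) (hinf : volume S = ⊤) :
    ∃ (x u : ℂ) (m y1 y2 p q : ℝ), ‖u‖ = 1 ∧ 0 < q ∧ q < p ∧ (p + q) * (y1 - y2) = 1 ∧
      frame x u (m - p, y1) ∈ S ∧ frame x u (m + p, y1) ∈ S ∧
      frame x u (m + q, y2) ∈ S ∧ frame x u (m - q, y2) ∈ S := by
  obtain ⟨x, g, hx, hgx, ha, hb⟩ := step1 S hS hinf
  obtain ⟨h, hh⟩ : ∃ h, h = ‖g - x‖ := ⟨_, rfl⟩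
  have hpos : 0 < h := by linarith
  have hC : (h : ℂ) ≠ 0 := by exact_mod_cast hpos.ne'
  have hg0 : g - x ≠ 0 := by rw [← norm_pos_iff, ← hh]; exact hpos
  have hc0 : (starRingEnd ℂ) (g - x) ≠ 0 := (map_ne_zero _).2 hg0
  obtain ⟨u, hu⟩ : ∃ u, u = -Complex.I * (g - x) / h := ⟨_, rfl⟩
  have hu1 : ‖u‖ = 1 := by
    rw [hu]; simp only [norm_div, norm_mul, norm_neg, Complex.norm_I, Complex.norm_real,
      Real.norm_eq_abs, abs_of_pos hpos, one_mul, ← hh]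
    exact div_self hpos.ne'
  have hmul : (g - x) * (starRingEnd ℂ) (g - x) = (h : ℂ) ^ 2 := by
    rw [Complex.mul_conj, Complex.normSq_eq_norm_sq, ← hh]; push_cast; rfl
  have hinv : 1 / (starRingEnd ℂ) (g - x) = (g - x) / (h : ℂ) ^ 2 := by
    rw [← hmul]; field_simp
  have hI := Complex.I_sq
  have e0 : frame x u (0, 0) = x := by simp [frame]
  have ea : frame x u (-(1 / h), h) = g + Complex.I / (starRingEnd ℂ) (g - x) := by
    rw [div_eq_mul_one_div Complex.I, hinv, frame, hu]; push_cast; field_simp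
    linear_combination (-(g - x) * (h : ℂ) ^ 2) * hI
  have eb : frame x u (1 / h, h) = g + (-Complex.I) / (starRingEnd ℂ) (g - x) := by
    rw [div_eq_mul_one_div (-Complex.I), hinv, frame, hu]; push_cast; field_simp
    linear_combination (-(g - x) * (h : ℂ) ^ 2) * hI
  obtain ⟨r1, hr1, h1⟩ := frame_dens S hS x u hu1 (0, 0) (by rw [e0]; exact hx)
  obtain ⟨r2, hr2, h2⟩ := frame_dens S hS x u hu1 (-(1 / h), h) (by rw [ea]; exact ha)
  obtain ⟨r3, hr3, h3⟩ := frame_dens S hS x u hu1 (1 / h, h) (by rw [eb]; exact hb)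
  obtain ⟨δ, hδ, d0, d1, d2, d3⟩ : ∃ δ : ℝ, 0 < δ ∧ δ ≤ 1 ∧ δ < r1 ∧ δ < r2 ∧ δ < r3 := by
    refine ⟨min 1 (min r1 (min r2 r3)) / 2, by positivity, ?_, ?_, ?_, ?_⟩
    all_goals
      have i1 := min_le_left 1 (min r1 (min r2 r3))
      have i2 := min_le_right 1 (min r1 (min r2 r3))
      have i3 := min_le_left r1 (min r2 r3)
      have i4 := min_le_right r1 (min r2 r3)
      have i5 := min_le_left r2 r3
      have i6 := min_le_right r2 r3
      linarith
  obtain ⟨m, y1, y2, p, q, hq, hpq, hA, m1, m2, m3, m4⟩ :=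
    step2 (frame x u ⁻¹' S) ((frame_mp x u hu1).measurable hS) h (by rw [hh]; exact hgx) δ hδ d0
      (h1 δ hδ d1) (h2 δ hδ d2) (h3 δ hδ d3)
  exact ⟨x, u, m, y1, y2, p, q, hu1, hq, hpq, hA, m1, m2, m3, m4⟩

/-- Every measurable subset of the plane of infinite Lebesgue measure contains the four
vertices of an isosceles trapezoid of area 1. -/
theorem isosceles_trapezoid_of_infinite_measure
    (S : Set (EuclideanSpace ℝ (Fin 2))) (hmeas : MeasurableSet S)
    (hinf : volume S = ⊤) :
    ∃ (a b c d : EuclideanSpace ℝ (Fin 2)) (t : ℝ),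
      a ∈ S ∧ b ∈ S ∧ c ∈ S ∧ d ∈ S ∧
      0 < t ∧ t ≠ 1 ∧ c - d = t • (b - a) ∧ b - a ≠ 0 ∧
      dist a d = dist b c ∧
      ¬ Collinear ℝ ({a, b, c, d} : Set (EuclideanSpace ℝ (Fin 2))) ∧
      (1 / 2) * |det2 (b - a) (d - a) + det2 (c - b) (d - b)| = 1 := by
  let φ := Complex.orthonormalBasisOneI.repr
  have hφ : MeasurePreserving φ := φ.measurePreserving
  obtain ⟨x, u, m, y1, y2, p, q, hu1, hq, hpq, hA, m1, m2, m3, m4⟩ :=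
    main_complex (φ ⁻¹' S) (hφ.measurable hmeas)
      (by rw [hφ.measure_preimage hmeas.nullMeasurableSet]; exact hinf)
  have hp : 0 < p := hq.trans hpq
  have hu2 : u.re ^ 2 + u.im ^ 2 = 1 := by
    have := Complex.normSq_eq_norm_sq u
    rw [hu1, Complex.normSq_apply] at this; linarith
  have c0 : ∀ z, (φ z) 0 = z.re := fun z => by
    exact congrFun (Complex.orthonormalBasisOneI_repr_apply z) 0
  have c1 : ∀ z, (φ z) 1 = z.im := fun z => by
    exact congrFun (Complex.orthonormalBasisOneI_repr_apply z) 1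
  have f0 : ∀ s t, (frame x u (s, t)).re = x.re + (u.re * s - u.im * t) := fun s t => by
    simp [frame]
  have f1 : ∀ s t, (frame x u (s, t)).im = x.im + (u.re * t + u.im * s) := fun s t => by
    simp [frame]
  have hdet : det2 (φ (frame x u (m + p, y1)) - φ (frame x u (m - p, y1)))
        (φ (frame x u (m - q, y2)) - φ (frame x u (m - p, y1))) +
      det2 (φ (frame x u (m + q, y2)) - φ (frame x u (m + p, y1)))
        (φ (frame x u (m - q, y2)) - φ (frame x u (m + p, y1))) = -2 := by
    simp only [det2, PiLp.sub_apply, c0, c1, f0, f1]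
    linear_combination (-2 * (p + q) * (y1 - y2)) * hu2 - 2 * hA
  refine ⟨φ (frame x u (m - p, y1)), φ (frame x u (m + p, y1)), φ (frame x u (m + q, y2)),
    φ (frame x u (m - q, y2)), q / p, m1, m2, m3, m4, by positivity,
    by rw [ne_eq, div_eq_one_iff_eq hp.ne']; exact hpq.ne, ?_, ?_, ?_, ?_, ?_⟩
  · ext i
    fin_cases i
    · simp [c0, f0]; field_simp; ring
    · simp [c1, f1]; field_simp; ring
  · intro h
    have i0 := congrArg (fun v : EuclideanSpace ℝ (Fin 2) => v 0) h
    have i1 := congrArg (fun v : EuclideanSpace ℝ (Fin 2) => v 1) h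
    simp only [PiLp.sub_apply, c0, c1, f0, f1, PiLp.zero_apply] at i0 i1
    have : 2 * p = 0 := by
      linear_combination (-2 * p) * hu2 + u.re * i0 + u.im * i1
    linarith
  · rw [EuclideanSpace.dist_eq, EuclideanSpace.dist_eq]
    congr 1
    simp only [Fin.sum_univ_two, Real.dist_eq, sq_abs, c0, c1, f0, f1]
    ring
  · intro hcol
    rw [collinear_iff_exists_forall_eq_smul_vadd] at hcol
    obtain ⟨p0, v, hv⟩ := hcol
    obtain ⟨ra, ha⟩ := hv _ (by simp : φ (frame x u (m - p, y1)) ∈ _)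
    obtain ⟨rb, hb⟩ := hv (φ (frame x u (m + p, y1))) (by simp)
    obtain ⟨rc, hc⟩ := hv (φ (frame x u (m + q, y2))) (by simp)
    obtain ⟨rd, hd⟩ := hv (φ (frame x u (m - q, y2))) (by simp)
    rw [ha, hb, hc, hd] at hdet
    simp only [det2, vadd_eq_add, PiLp.sub_apply, PiLp.add_apply, PiLp.smul_apply,
      smul_eq_mul] at hdet
    ring_nf at hdet
    norm_num at hdet
  · rw [hdet]; norm_num
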